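/- arXiv:2505.08570 — 2 statements merged into one kernel-verified Lean document; each statement's English description precedes it below -/
import Mathlib

section
/- Let Y be a 2×2 real symmetric positive definite matrix and let Z be a 2×2 complex matrix such that Z² = 0 and the matrix Z·Y is Hermitian (i.e. equal to its conjugate transpose). Then Z = 0. -/
open Matrix

theorem stmt1 (Y : Matrix (Fin 2) (Fin 2) ℝ) (hY : Y.PosDef)
    (Z : Matrix (Fin 2) (Fin 2) ℂ) (hZ : Z * Z = 0)
    (hH : (Z * Y.map Complex.ofReal).IsHermitian) : Z = 0 := by
  have hU : IsUnit (Y.map Complex.ofReal) := 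
    hY.isUnit.map (Complex.ofRealHom.mapMatrix (m := Fin 2))
  obtain ⟨B, hB⟩ : ∃ B : Matrix (Fin 2) (Fin 2) ℝ, Y = Bᴴ * B := by
    open scoped MatrixOrder in
    exact CStarAlgebra.nonneg_iff_eq_star_mul_self.mp hY.posSemidef.nonneg
  have hC : Y.map Complex.ofReal = (B.map Complex.ofReal)ᴴ * B.map Complex.ofReal := by
    rw [hB]
    ext i j
    simp [Matrix.mul_apply]
  generalize Y.map Complex.ofReal = W at *
  generalize B.map Complex.ofReal = C at *
  have h1 : W * Zᴴ = Z * W := by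
    have h := hH.eq
    rw [conjTranspose_mul] at h
    rw [← h, hC]
    simp
  have h2 : (Z * Cᴴ) * (Z * Cᴴ)ᴴ = 0 := by
    rw [conjTranspose_mul, conjTranspose_conjTranspose, Matrix.mul_assoc, ← Matrix.mul_assoc Cᴴ,
      ← hC, h1, ← Matrix.mul_assoc, hZ, Matrix.zero_mul]
  have h3 : Z * Cᴴ = 0 := by
    open scoped ComplexOrder in
    exact self_mul_conjTranspose_eq_zero.mp h2
  have h4 : Z * W = 0 := by rw [hC, ← Matrix.mul_assoc, h3, Matrix.zero_mul]
  exact (hU.mul_left_eq_zero).mp h4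
end

section
/- Let Y be a 2×2 real symmetric positive definite matrix and let M be a 2×2 complex matrix such that M·Y is Hermitian. If tr(M)² − 4·det(M) = 0 and the entries of the characteristic polynomial of M are integers (tr(M), det(M) ∈ ℤ), then M is an integer scalar matrix, i.e. M = m·I for some m ∈ ℤ. -/
open Matrix

lemma aux_quad (p q r x y u v : ℝ) (hp : 0 < p) (hdet : 0 < p * r - q * q)
    (h : (p * x ^ 2 + 2 * q * x * y + r * y ^ 2) + (p * u ^ 2 + 2 * q * u * v + r * v ^ 2) = 0) :
    x = 0 ∧ y = 0 ∧ u = 0 ∧ v = 0 := by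
  have e : (p * x + q * y) ^ 2 + (p * u + q * v) ^ 2 + (p * r - q * q) * (y ^ 2 + v ^ 2) = 0 := by
    linear_combination p * h
  have h1 : (p * r - q * q) * (y ^ 2 + v ^ 2) = 0 := by
    have : 0 ≤ (p * r - q * q) * (y ^ 2 + v ^ 2) := by
      have : 0 ≤ y ^ 2 + v ^ 2 := by positivity
      exact mul_nonneg hdet.le this
    nlinarith [sq_nonneg (p * x + q * y), sq_nonneg (p * u + q * v)]
  have h2 : y ^ 2 + v ^ 2 = 0 := (mul_eq_zero.mp h1).resolve_left hdet.ne'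
  have hy : y = 0 := pow_eq_zero_iff two_ne_zero |>.mp (by nlinarith [sq_nonneg y, sq_nonneg v])
  have hv : v = 0 := pow_eq_zero_iff two_ne_zero |>.mp (by nlinarith [sq_nonneg y, sq_nonneg v])
  subst hy hv
  have h3 : x ^ 2 + u ^ 2 = 0 := by
    have : p * (x ^ 2 + u ^ 2) = 0 := by linear_combination h
    exact (mul_eq_zero.mp this).resolve_left hp.ne'
  have hx : x = 0 := pow_eq_zero_iff two_ne_zero |>.mp (by nlinarith [sq_nonneg x, sq_nonneg u])
  have hu : u = 0 := pow_eq_zero_iff two_ne_zero |>.mp (by nlinarith [sq_nonneg x, sq_nonneg u])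
  exact ⟨hx, rfl, hu, rfl⟩

theorem stmt3 (Y : Matrix (Fin 2) (Fin 2) ℝ) (hY : Y.PosDef)
    (M : Matrix (Fin 2) (Fin 2) ℂ)
    (hH : (M * Y.map Complex.ofReal).IsHermitian)
    (hdisc : M.trace ^ 2 - 4 * M.det = 0)
    (ht : ∃ t : ℤ, M.trace = (t : ℂ)) (hd : ∃ d : ℤ, M.det = (d : ℂ)) :
    ∃ m : ℤ, M = (m : ℂ) • (1 : Matrix (Fin 2) (Fin 2) ℂ) := by
  obtain ⟨t, ht⟩ := ht
  obtain ⟨d, hd⟩ := hd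
  have htd : t ^ 2 = 4 * d := by
    rw [ht, hd] at hdisc
    have : t ^ 2 - 4 * d = 0 := by exact_mod_cast hdisc
    linarith
  have heven : Even t := by
    have : Even (t ^ 2) := ⟨2 * d, by linarith⟩
    exact (Int.even_pow.mp this).1
  obtain ⟨m, rfl⟩ := heven
  have hdm : d = m ^ 2 := by nlinarith
  subst hdm
  refine ⟨m, ?_⟩
  have hsym : Y 1 0 = Y 0 1 := by simpa using hY.isHermitian.apply 0 1
  have hp : 0 < Y 0 0 := hY.diag_pos
  have hdet : 0 < Y 0 0 * Y 1 1 - Y 0 1 * Y 0 1 := by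
    have := hY.det_pos
    rwa [Matrix.det_fin_two, hsym] at this
  set Z : Matrix (Fin 2) (Fin 2) ℂ := Y.map Complex.ofReal with hZ
  have hZH : Zᴴ = Z := by
    ext i j
    fin_cases i <;> fin_cases j <;> simp [hZ, hsym]
  obtain ⟨N, hN⟩ : ∃ N, N = M - (m : ℂ) • (1 : Matrix (Fin 2) (Fin 2) ℂ) := ⟨_, rfl⟩
  have hNZ : Z * Nᴴ = N * Z := by
    have h1 : Z * Mᴴ = M * Z := by
      have := hH.eq
      rwa [conjTranspose_mul, hZH] at this
    rw [hN]
    simp [mul_sub, sub_mul, h1]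
  have hNN : N * N = 0 := by
    rw [Matrix.trace_fin_two] at ht
    rw [Matrix.det_fin_two] at hd
    push_cast at ht hd
    rw [hN]
    ext i j
    fin_cases i <;> fin_cases j <;> simp [Matrix.mul_apply, Fin.sum_univ_two]
    · linear_combination M 0 0 * ht - hd
    · linear_combination M 0 1 * ht
    · linear_combination M 1 0 * ht
    · linear_combination M 1 1 * ht - hd
  have hA : N * (Z * Nᴴ) = 0 := by rw [hNZ, ← mul_assoc, hNN, zero_mul]
  have key : ∀ i, N i 0 = 0 ∧ N i 1 = 0 := by
    intro i
    have h := congrArg Complex.re (congrFun (congrFun hA i) i)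
    simp [Matrix.mul_apply, Fin.sum_univ_two, hZ, hsym] at h
    obtain ⟨a, b, c, e⟩ := aux_quad (Y 0 0) (Y 0 1) (Y 1 1) (N i 0).re (N i 1).re
      (N i 0).im (N i 1).im hp hdet (by linear_combination h)
    exact ⟨Complex.ext a c, Complex.ext b e⟩
  have hN0 : N = 0 := by
    ext i j
    fin_cases j
    · exact (key i).1
    · exact (key i).2
  rw [hN] at hN0
  exact sub_eq_zero.mp hN0
end
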